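/- For every m with 1 ≤ m ≤ 3 and every n ≥ 3, sdepth_{S_{n,m}}(I(C_{n,m})) ≥ sdepth(S_{n,m}/I(C_{n,m})). -/

import Mathlib

open MvPolynomial

section Defs

variable (K : Type) [Field K] (σ : Type)
variable (M : Type) [AddCommGroup M] [Module K M] [Module (MvPolynomial σ K) M]
  [IsScalarTower K (MvPolynomial σ K) M]

/-- The Stanley space `w K[A]`: the `K`-span of `{u • w : u a monomial in the variables of A}`. -/
noncomputable def stanleySpace (w : M) (A : Finset σ) : Submodule K M :=
  Submodule.span K { m | ∃ u : σ →₀ ℕ, (↑u.support : Set σ) ⊆ ↑A ∧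
    m = (monomial u (1 : K) : MvPolynomial σ K) • w }

/-- `(w, A)` indexed by `Fin r` gives a Stanley decomposition of `M`:
each Stanley space `wᵢ K[Aᵢ]` is a free `K[Aᵢ]`-module and `M` is their internal direct
sum as a `K`-vector space. -/
def IsStanleyDecomp {r : ℕ} (w : Fin r → M) (A : Fin r → Finset σ) : Prop :=
  (∀ i (f : MvPolynomial σ K), (↑f.vars : Set σ) ⊆ ↑(A i) → f • w i = 0 → f = 0) ∧
  (iSupIndep fun i => stanleySpace K σ M (w i) (A i)) ∧
  (⨆ i, stanleySpace K σ M (w i) (A i)) = ⊤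

/-- The Stanley depth of `M`: the largest value of `minᵢ |Aᵢ|` over all Stanley
decompositions of `M`. -/
noncomputable def sdepth : ℕ :=
  sSup { d | ∃ r, ∃ w : Fin r → M, ∃ A : Fin r → Finset σ,
    IsStanleyDecomp K σ M w A ∧ d = sInf (Set.range fun i => (A i).card) }

/-- The depth of `M` with respect to the maximal graded ideal `(x₁, …, x_N)`:
the maximal length of an `M`-regular sequence of elements of that ideal. -/
noncomputable def rdepth : ℕ :=
  sSup { d | ∃ rs : List (MvPolynomial σ K), rs.length = d ∧
    (∀ f ∈ rs, f ∈ Ideal.span (Set.range (X : σ → MvPolynomial σ K))) ∧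
    RingTheory.Sequence.IsRegular M rs }

end Defs

/-- Adjacency in the strong product `Pₙ ⊠ Pₘ` (vertices `(i,j)`, `0`-indexed): distinct
vertices are adjacent iff both coordinates differ by at most `1`. -/
def pAdj (n m : ℕ) (a b : Fin n × Fin m) : Prop :=
  a ≠ b ∧ |((a.1 : ℤ) - (b.1 : ℤ))| ≤ 1 ∧ |((a.2 : ℤ) - (b.2 : ℤ))| ≤ 1

/-- Adjacency in the strong product `Cₙ ⊠ Pₘ` (vertices `(i,j)`, `0`-indexed). -/
def cAdj (n m : ℕ) (a b : Fin n × Fin m) : Prop :=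
  a ≠ b ∧ min ((a.1 : ℤ) - (b.1 : ℤ)).natAbs (n - ((a.1 : ℤ) - (b.1 : ℤ)).natAbs) ≤ 1 ∧
    |((a.2 : ℤ) - (b.2 : ℤ))| ≤ 1

/-- The edge ideal of the graph with vertex set `V` and adjacency relation `Adj`. -/
noncomputable def edgeIdeal (K : Type) [Field K] {V : Type} (Adj : V → V → Prop) :
    Ideal (MvPolynomial V K) :=
  Ideal.span { p | ∃ a b : V, Adj a b ∧ p = X a * X b }


/-- running state -/
def runState (P : ℕ → Prop) [DecidablePred P] (s0 : Bool) : ℕ → Bool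
  | 0 => s0
  | x + 1 => if P x then Nat.bodd x else runState P s0 x

lemma runState_zero (P : ℕ → Prop) [DecidablePred P] (s0 : Bool) : runState P s0 0 = s0 := rfl

lemma runState_succ (P : ℕ → Prop) [DecidablePred P] (s0 : Bool) (x : ℕ) :
    runState P s0 (x+1) = if P x then Nat.bodd x else runState P s0 x := rfl

lemma runState_congr (P P' : ℕ → Prop) [DecidablePred P] [DecidablePred P'] (s0 : Bool) (k : ℕ)
    (h1 : ∀ x < k, runState P s0 x ≠ runState P s0 (x+1) → P' x)
    (h2 : ∀ x < k, P' x → runState P s0 (x+1) = Nat.bodd x) :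
    ∀ x ≤ k, runState P' s0 x = runState P s0 x := by
  intro x
  induction x with
  | zero => intro _; rfl
  | succ x ih =>
    intro hx
    rw [runState_succ P']
    by_cases hp : P' x
    · simp only [hp, if_true]; exact (h2 x (by omega) hp).symm
    · simp only [hp, if_false]
      rw [ih (by omega)]
      by_contra hne
      exact hp (h1 x (by omega) hne)

lemma runState_indep (P : ℕ → Prop) [DecidablePred P] (s0 s1 : Bool) (y : ℕ) (hy : P y) :
    ∀ k, y < k → runState P s0 k = runState P s1 k := by
  intro k
  induction k with
  | zero => intro h; omega
  | succ k ih =>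
    intro h
    rw [runState_succ, runState_succ]
    by_cases hp : P k
    · simp [hp]
    · simp only [hp, if_false]
      apply ih
      rcases Nat.lt_succ_iff_lt_or_eq.mp h with h | h
      · exact h
      · subst h; exact absurd hy hp

lemma runState_empty (P : ℕ → Prop) [DecidablePred P] (s0 : Bool) (k : ℕ) (h : ∀ x < k, ¬ P x) :
    runState P s0 k = s0 := by
  induction k with
  | zero => rfl
  | succ k ih =>
    rw [runState_succ, if_neg (h k (by omega)), ih (fun x hx => h x (by omega))]

lemma runState_const (P : ℕ → Prop) [DecidablePred P] (s0 : Bool) (k : ℕ)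
    (h : ∀ x < k, runState P s0 x = runState P s0 (x+1)) :
    runState P s0 k = s0 := by
  induction k with
  | zero => rfl
  | succ k ih => rw [← h k (by omega), ih (fun x hx => h x (by omega))]

lemma runState_count (P : ℕ → Prop) [DecidablePred P] (s0 : Bool) (k : ℕ) :
    (k : ℤ) + (if runState P s0 0 = Nat.bodd 0 then 1 else 0) ≤
      2 * (((Finset.range k).filter (fun x => runState P s0 (x+1) = Nat.bodd x)).card : ℤ) +
      (if runState P s0 k = Nat.bodd k then 1 else 0) := by
  induction k with
  | zero => simp
  | succ k ih =>
    rw [Finset.range_add_one, Finset.filter_insert]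
    have hS := runState_succ P s0 k
    by_cases hB : runState P s0 (k+1) = Nat.bodd k
    · rw [if_pos hB, Finset.card_insert_of_notMem (by simp)]
      push_cast
      split_ifs at ih ⊢ <;> linarith
    · rw [if_neg hB]
      have hp : ¬ P k := by
        intro hp; rw [if_pos hp] at hS; exact hB hS
      rw [if_neg hp] at hS
      rw [hS] at hB
      rw [if_neg hB] at ih
      have : runState P s0 (k+1) = Nat.bodd (k+1) := by
        rw [hS, Nat.bodd_succ]
        cases h : Nat.bodd k <;> cases h' : runState P s0 k <;> simp_all
      rw [if_pos this]
      push_cast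
      linarith

lemma runState_count' (P : ℕ → Prop) [DecidablePred P] (s0 : Bool) (k : ℕ)
    (hk : runState P s0 k = !s0) :
    k ≤ 2 * ((Finset.range k).filter (fun x => runState P s0 (x+1) = Nat.bodd x)).card := by
  have h := runState_count P s0 k
  rw [hk, runState_zero] at h
  by_cases h2 : Nat.bodd k = true
  · rw [h2] at h
    cases s0 <;> simp at h <;> omega
  · have h3 : k % 2 = 0 := by
      rw [Nat.mod_two_of_bodd]; simp [h2]
    split_ifs at h <;> omega

lemma max_ideal_intervals {V : Type} [DecidableEq V] (Y : Finset V) :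
    ∃ a b : Finset V → Finset V, ∀ X, X ⊆ Y → X.Nonempty →
      a X ⊆ X ∧ X ⊆ b X ∧ b X ⊆ Y ∧ (a X).Nonempty ∧ Y.card ≤ 2 * (b X).card ∧
      ∀ X', a X ⊆ X' → X' ⊆ b X → a X' = a X ∧ b X' = b X := by
  classical
  obtain ⟨f, hf1, hf2⟩ : ∃ f : V → ℕ, Set.InjOn f Y ∧ Y.image f = Finset.range Y.card := by
    refine ⟨fun v => if h : v ∈ Y then (Y.equivFin ⟨v, h⟩ : ℕ) else 0, ?_, ?_⟩
    · intro u hu v hv h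
      have hu' : u ∈ Y := hu
      have hv' : v ∈ Y := hv
      simp only [hu', hv', dif_pos] at h
      have := Y.equivFin.injective (Fin.ext h)
      simpa using this
    · ext x
      simp only [Finset.mem_image, Finset.mem_range]
      constructor
      · rintro ⟨v, hv, rfl⟩
        simp [hv]
      · intro hx
        refine ⟨(Y.equivFin.symm ⟨x, hx⟩ : V), (Y.equivFin.symm ⟨x, hx⟩).2, ?_⟩
        simp
  let k := Y.card
  have hfk : ∀ v ∈ Y, f v < k := by
    intro v hv
    have : f v ∈ Y.image f := Finset.mem_image_of_mem f hv
    rw [hf2] at this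
    simpa using this
  have hfs : ∀ x < k, ∃ v ∈ Y, f v = x := by
    intro x hx
    have : x ∈ Y.image f := by rw [hf2]; simpa using hx
    simpa using this
  let P : Finset V → ℕ → Prop := fun X x => x ∈ X.image f
  let s0 : Finset V → Bool := fun X => ! runState (P X) true k
  let s : Finset V → ℕ → Bool := fun X => runState (P X) (s0 X)
  have hP : ∀ X ⊆ Y, ∀ v ∈ Y, P X (f v) ↔ v ∈ X := by
    intro X hX v hv
    constructor
    · intro h
      obtain ⟨u, hu, huv⟩ := Finset.mem_image.mp h
      rw [← hf1 (hX hu) hv huv]; exact hu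
    · intro h; exact Finset.mem_image_of_mem f h
  refine ⟨fun X => Y.filter (fun v => s X (f v) ≠ s X (f v + 1)),
    fun X => Y.filter (fun v => s X (f v + 1) = Nat.bodd (f v)), ?_⟩
  intro X hX hne
  have hcons : s X k = ! s0 X := by
    obtain ⟨v, hv⟩ := hne
    have := runState_indep (P X) (s0 X) true (f v) ((hP X hX v (hX hv)).2 hv) k (hfk v (hX hv))
    simp only [s, s0] at this ⊢
    rw [this]; simp
  refine ⟨?_, ?_, Finset.filter_subset _ _, ?_, ?_, ?_⟩
  · intro v hv
    rw [Finset.mem_filter] at hv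
    by_contra hvX
    apply hv.2
    simp only [s]
    rw [runState_succ, if_neg (fun h => hvX ((hP X hX v hv.1).1 h))]
  · intro v hv
    rw [Finset.mem_filter]
    refine ⟨hX hv, ?_⟩
    simp only [s]
    rw [runState_succ, if_pos ((hP X hX v (hX hv)).2 hv)]
  · by_contra hemp
    rw [Finset.not_nonempty_iff_eq_empty] at hemp
    change Y.filter (fun v => s X (f v) ≠ s X (f v + 1)) = ∅ at hemp
    have := runState_const (P X) (s0 X) k (by
      intro x hx
      obtain ⟨v, hv, rfl⟩ := hfs x hx
      by_contra hc
      have : v ∈ Y.filter (fun v => s X (f v) ≠ s X (f v + 1)) := by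
        rw [Finset.mem_filter]; exact ⟨hv, hc⟩
      rw [hemp] at this
      simp at this)
    change s X k = s0 X at this
    rw [hcons] at this
    simp at this
  · have h1 := runState_count' (P X) (s0 X) k hcons
    have h2 : (Finset.range k).filter (fun x => runState (P X) (s0 X) (x+1) = Nat.bodd x) ⊆
        (Y.filter (fun v => s X (f v + 1) = Nat.bodd (f v))).image f := by
      intro x hx
      rw [Finset.mem_filter, Finset.mem_range] at hx
      obtain ⟨v, hv, rfl⟩ := hfs x hx.1
      exact Finset.mem_image_of_mem f (Finset.mem_filter.mpr ⟨hv, hx.2⟩)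
    have h3 := (Finset.card_le_card h2).trans Finset.card_image_le
    change Y.card ≤ _ at h1
    exact h1.trans (Nat.mul_le_mul_left 2 h3)
  · intro X' h1 h2
    have hX' : X' ⊆ Y := h2.trans (Finset.filter_subset _ _)
    have hc := runState_congr (P X) (P X') (s0 X) k
      (by
        intro x hx hne
        obtain ⟨v, hv, rfl⟩ := hfs x hx
        exact (hP X' hX' v hv).2 (h1 (Finset.mem_filter.mpr ⟨hv, hne⟩)))
      (by
        intro x hx hp
        obtain ⟨v, hv, rfl⟩ := hfs x hx
        exact (Finset.mem_filter.mp (h2 ((hP X' hX' v hv).1 hp))).2)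
    have hs0 : s0 X' = s0 X := by
      have hk := hc k le_rfl
      change _ = s X k at hk
      rw [hcons] at hk
      have hex : ∃ x < k, P X' x := by
        by_contra hno
        push Not at hno
        rw [runState_empty (P X') (s0 X) k hno] at hk
        simp at hk
      obtain ⟨y, hy, hPy⟩ := hex
      have := runState_indep (P X') (s0 X) true y hPy k hy
      simp only [s0] at hk this ⊢
      rw [← this, hk]; simp
    have hs : ∀ x ≤ k, s X' x = s X x := by
      intro x hx
      simp only [s]
      rw [hs0]
      exact hc x hx
    constructor
    · apply Finset.filter_congr
      intro v hv
      have := hfk v hv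
      rw [hs _ (by omega), hs _ (by omega)]
    · apply Finset.filter_congr
      intro v hv
      have := hfk v hv
      rw [hs _ (by omega)]

/-- The set contains an edge. -/
def HasEdge {V : Type} (Adj : V → V → Prop) (C : Finset V) : Prop :=
  ∃ a ∈ C, ∃ b ∈ C, Adj a b

lemma HasEdge.mono {V : Type} {Adj : V → V → Prop} {C C' : Finset V} (h : HasEdge Adj C)
    (hs : C ⊆ C') : HasEdge Adj C' := by
  obtain ⟨a, ha, b, hb, hab⟩ := h
  exact ⟨a, hs ha, b, hs hb, hab⟩

lemma mem_edgeIdeal_iff (K : Type) [Field K] {V : Type} [DecidableEq V] (Adj : V → V → Prop)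
    (hirr : ∀ v, ¬ Adj v v) (f : MvPolynomial V K) :
    f ∈ edgeIdeal K Adj ↔ ∀ u ∈ f.support, HasEdge Adj u.support := by
  have h1 : edgeIdeal K Adj = Ideal.span ((fun s => monomial s (1 : K)) ''
      { s | ∃ a b : V, Adj a b ∧ s = Finsupp.single a 1 + Finsupp.single b 1 }) := by
    unfold edgeIdeal
    congr 1
    ext p
    constructor
    · rintro ⟨a, b, hab, rfl⟩
      exact ⟨_, ⟨a, b, hab, rfl⟩, by simp [X, monomial_mul]⟩
    · rintro ⟨_, ⟨a, b, hab, rfl⟩, rfl⟩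
      exact ⟨a, b, hab, by simp [X, monomial_mul]⟩
  rw [h1, mem_ideal_span_monomial_image]
  refine forall₂_congr fun u _ => ?_
  constructor
  · rintro ⟨_, ⟨a, b, hab, rfl⟩, hle⟩
    refine ⟨a, ?_, b, ?_, hab⟩
    · have := hle a
      simp only [Finsupp.add_apply, Finsupp.single_eq_same] at this
      rw [Finsupp.mem_support_iff]; omega
    · have := hle b
      simp only [Finsupp.add_apply, Finsupp.single_eq_same] at this
      rw [Finsupp.mem_support_iff]; omega
  · rintro ⟨a, ha, b, hb, hab⟩
    refine ⟨_, ⟨a, b, hab, rfl⟩, ?_⟩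
    have hne : a ≠ b := by rintro rfl; exact hirr _ hab
    rw [Finsupp.mem_support_iff] at ha hb
    intro v
    simp only [Finsupp.add_apply, Finsupp.single_apply]
    split_ifs with h1 h2 h2
    · exact absurd (h1.trans h2.symm) hne
    · subst h1; omega
    · subst h2; omega
    · omega

lemma sdepth_quot_le (K : Type) [Field K] {V : Type} (Adj : V → V → Prop) (d : ℕ)
    (h : ∀ A : Finset V, ¬ HasEdge Adj A → A.card ≤ d) :
    sdepth K V (MvPolynomial V K ⧸ edgeIdeal K Adj) ≤ d := by
  unfold sdepth
  apply csSup_le'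
  rintro _ ⟨r, w, A, ⟨hfree, -, -⟩, rfl⟩
  rcases Nat.eq_zero_or_pos r with rfl | hr
  · simp
  · refine (Nat.sInf_le (Set.mem_range_self (⟨0, hr⟩ : Fin r))).trans ?_
    apply h
    rintro ⟨a, ha, b, hb, hab⟩
    have := hfree ⟨0, hr⟩ (X a * X b) (by
      classical
      intro v hv
      have := MvPolynomial.vars_mul _ _ hv
      rw [Finset.mem_union, vars_X, vars_X, Finset.mem_singleton, Finset.mem_singleton] at this
      rcases this with rfl | rfl <;> assumption) (by
      obtain ⟨p, hp⟩ := Ideal.Quotient.mk_surjective (w ⟨0, hr⟩)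
      rw [← hp]
      change Ideal.Quotient.mk _ ((X a * X b) * p) = 0
      rw [Ideal.Quotient.eq_zero_iff_mem]
      exact Ideal.mul_mem_right _ _ (Ideal.subset_span ⟨a, b, hab, rfl⟩))
    exact mul_ne_zero (X_ne_zero a) (X_ne_zero b) this

lemma le_sdepth_of_intervals (K : Type) [Field K] {V : Type} [Fintype V] [DecidableEq V]
    (Adj : V → V → Prop) (hirr : ∀ v, ¬ Adj v v) (hex : ∃ a b, Adj a b) (d : ℕ)
    (β τ : Finset V → Finset V)
    (h : ∀ C, HasEdge Adj C → β C ⊆ C ∧ C ⊆ τ C ∧ d ≤ (τ C).card ∧ HasEdge Adj (β C) ∧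
      ∀ C', β C ⊆ C' → C' ⊆ τ C → β C' = β C ∧ τ C' = τ C) :
    d ≤ sdepth K V (edgeIdeal K Adj) := by
  classical
  let P : Finset (Finset V × Finset V) :=
    (Finset.univ.filter (HasEdge Adj)).image (fun C => (β C, τ C))
  have hP : ∀ p ∈ P, HasEdge Adj p.1 ∧ d ≤ p.2.card ∧
      ∀ C', p.1 ⊆ C' → C' ⊆ p.2 → (β C', τ C') = p := by
    intro p hp
    obtain ⟨C, hC, rfl⟩ := Finset.mem_image.mp hp
    obtain ⟨-, -, h3, h4, h5⟩ := h C (Finset.mem_filter.mp hC).2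
    refine ⟨h4, h3, fun C' h1 h2 => ?_⟩
    obtain ⟨e1, e2⟩ := h5 C' h1 h2
    rw [e1, e2]
  let e : Fin P.card ≃ P := P.equivFin.symm
  let ind : Finset V → (V →₀ ℕ) := fun A => Finsupp.indicator A (fun _ _ => 1)
  have hind : ∀ A v, ind A v = if v ∈ A then 1 else 0 := by
    intro A v; simp [ind, Finsupp.indicator_apply]
  have hinds : ∀ A, (ind A).support = A := by
    intro A; ext v; rw [Finsupp.mem_support_iff, hind]; simp
  let w : Fin P.card → edgeIdeal K Adj := fun i =>
    ⟨monomial (ind (e i).1.1) 1, by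
      rw [mem_edgeIdeal_iff K Adj hirr]
      intro u hu
      have := support_monomial_subset hu
      rw [Finset.mem_singleton] at this
      rw [this, hinds]
      exact (hP _ (e i).2).1⟩
  let A : Fin P.card → Finset V := fun i => (e i).1.2
  let T : Fin P.card → Set (V →₀ ℕ) := fun i => {u | (e i).1.1 ⊆ u.support ∧ u.support ⊆ (e i).1.2}
  have hsub : ∀ i, (e i).1.1 ⊆ (e i).1.2 := by
    intro i
    obtain ⟨C, hC, hCe⟩ := Finset.mem_image.mp (e i).2
    rw [← hCe]
    obtain ⟨h1, h2, -⟩ := h C (Finset.mem_filter.mp hC).2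
    exact h1.trans h2
  have hTinj : ∀ i j u, u ∈ T i → u ∈ T j → i = j := by
    intro i j u hi hj
    have h1 := (hP _ (e i).2).2.2 u.support hi.1 hi.2
    have h2 := (hP _ (e j).2).2.2 u.support hj.1 hj.2
    exact e.injective (Subtype.ext (h1.symm.trans h2))
  have hle : ∀ i, stanleySpace K V (edgeIdeal K Adj) (w i) (A i) ≤
      { carrier := {f | ∀ u ∈ (f : MvPolynomial V K).support, u ∈ T i}
        add_mem' := by
          intro f g hf hg u hu
          rcases Finset.mem_union.mp (support_add hu) with h | h
          · exact hf u h
          · exact hg u h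
        zero_mem' := by intro u hu; simp at hu
        smul_mem' := by
          intro c f hf u hu
          exact hf u (support_smul hu) } := by
    intro i
    apply Submodule.span_le.mpr
    rintro _ ⟨v, hv, rfl⟩ u hu
    have hu' : u ∈ (monomial v (1:K) * monomial (ind (e i).1.1) 1).support := hu
    rw [monomial_mul] at hu'
    have := support_monomial_subset hu'
    rw [Finset.mem_singleton] at this
    subst this
    constructor
    · intro x hx
      rw [Finsupp.mem_support_iff, Finsupp.add_apply, hind, if_pos hx]; omega
    · intro x hx
      rcases Finset.mem_union.mp (Finsupp.support_add hx) with h | h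
      · exact hv h
      · rw [hinds] at h; exact hsub i h
  have hdec : IsStanleyDecomp K V (edgeIdeal K Adj) w A := by
    refine ⟨?_, ?_, ?_⟩
    · intro i f _ hf
      have : f * monomial (ind (e i).1.1) 1 = 0 := congrArg Subtype.val hf
      rcases mul_eq_zero.mp this with h | h
      · exact h
      · rw [monomial_eq_zero] at h; exact absurd h one_ne_zero
    · intro i
      rw [Submodule.disjoint_def]
      intro f hf1 hf2
      have h1 := hle i hf1
      have h2 : (⨆ (j) (_ : j ≠ i), stanleySpace K V (edgeIdeal K Adj) (w j) (A j)) ≤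
        { carrier := {f | ∀ u ∈ (f : MvPolynomial V K).support, u ∉ T i}
          add_mem' := by
            intro f g hf hg u hu
            rcases Finset.mem_union.mp (support_add hu) with h | h
            · exact hf u h
            · exact hg u h
          zero_mem' := by intro u hu; simp at hu
          smul_mem' := by
            intro c f hf u hu
            exact hf u (support_smul hu) } := by
        refine iSup₂_le fun j hj => (hle j).trans ?_
        intro g hg u hu hui
        exact hj (hTinj j i u (hg u hu) hui)
      have h3 := h2 hf2
      apply Subtype.ext
      change (f : MvPolynomial V K) = 0
      rw [← support_eq_empty, Finset.eq_empty_iff_forall_notMem]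
      intro u hu
      exact h3 u hu (h1 u hu)
    · rw [eq_top_iff]
      rintro ⟨f, hf⟩ -
      have hmon := (mem_edgeIdeal_iff K Adj hirr f).1 hf
      have hmem : ∀ u ∈ f.support, monomial u (1:K) ∈ edgeIdeal K Adj := by
        intro u hu
        rw [mem_edgeIdeal_iff K Adj hirr]
        intro u' hu'
        have := support_monomial_subset hu'
        rw [Finset.mem_singleton] at this
        rw [this]; exact hmon u hu
      have hfs : (⟨f, hf⟩ : edgeIdeal K Adj) =
          ∑ u ∈ f.support.attach, (coeff u.1 f) • (⟨monomial u.1 1, hmem u.1 u.2⟩ : edgeIdeal K Adj) := by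
        apply Subtype.ext
        rw [AddSubmonoidClass.coe_finsetSum]
        refine (f.as_sum.trans (Finset.sum_attach _ _).symm).trans ?_
        refine Finset.sum_congr rfl fun u _ => ?_
        change _ = coeff u.1 f • monomial u.1 (1:K)
        rw [smul_monomial, smul_eq_mul, mul_one]
      rw [hfs]
      refine Submodule.sum_mem _ fun u _ => Submodule.smul_mem _ _ ?_
      have hu := hmon u.1 u.2
      have hp : (β u.1.support, τ u.1.support) ∈ P :=
        Finset.mem_image.mpr ⟨u.1.support, by simpa using hu, rfl⟩
      obtain ⟨hb, ht, -⟩ := h _ hu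
      refine Submodule.mem_iSup_of_mem (e.symm ⟨_, hp⟩) (Submodule.subset_span ?_)
      refine ⟨u.1 - ind (β u.1.support), ?_, ?_⟩
      · intro x hx
        simp only [A, Equiv.apply_symm_apply]
        apply ht
        have hx' : x ∈ (u.1 - ind (β u.1.support)).support := hx
        rw [Finsupp.mem_support_iff, Finsupp.tsub_apply] at hx'
        rw [Finsupp.mem_support_iff]; omega
      · apply Subtype.ext
        change monomial u.1 (1:K) = monomial _ 1 * monomial _ 1
        rw [Equiv.apply_symm_apply, monomial_mul, one_mul]
        congr 1
        rw [tsub_add_cancel_of_le]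
        intro x
        rw [hind]
        split_ifs with hx
        · have := hb hx
          rw [Finsupp.mem_support_iff] at this; omega
        · omega
  have hPpos : 0 < P.card := by
    obtain ⟨a, b, hab⟩ := hex
    apply Finset.card_pos.mpr
    exact ⟨_, Finset.mem_image.mpr ⟨{a, b}, by simpa using ⟨a, by simp, b, by simp, hab⟩, rfl⟩⟩
  have hmem : sInf (Set.range fun i => (A i).card) ∈ { d | ∃ r, ∃ w : Fin r → edgeIdeal K Adj,
      ∃ A : Fin r → Finset V, IsStanleyDecomp K V (edgeIdeal K Adj) w A ∧
        d = sInf (Set.range fun i => (A i).card) } := ⟨_, w, A, hdec, rfl⟩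
  have hbdd : BddAbove { d | ∃ r, ∃ w : Fin r → edgeIdeal K Adj,
      ∃ A : Fin r → Finset V, IsStanleyDecomp K V (edgeIdeal K Adj) w A ∧
        d = sInf (Set.range fun i => (A i).card) } := by
    refine ⟨Fintype.card V, ?_⟩
    rintro _ ⟨r, w, A, -, rfl⟩
    rcases Nat.eq_zero_or_pos r with rfl | hr
    · simp
    · exact (Nat.sInf_le (Set.mem_range_self (⟨0, hr⟩ : Fin r))).trans (Finset.card_le_univ _)
  refine le_trans ?_ (le_csSup hbdd hmem)
  apply le_csInf
  · exact ⟨_, Set.mem_range_self (⟨0, hPpos⟩ : Fin P.card)⟩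
  · rintro _ ⟨i, rfl⟩
    exact (hP _ (e i).2).2.1

lemma graph_intervals {V : Type} [Fintype V] [DecidableEq V] (Adj : V → V → Prop)
    [DecidableRel Adj]
    (hsymm : ∀ a b, Adj a b → Adj b a) (D W0 : Finset V) (Q : V → Finset V)
    (hD : ¬ HasEdge Adj D) (hDW : Disjoint D W0)
    (hQ : ∀ f ∈ W0, ∀ q ∈ Q f, Adj f q ∧ q ∉ D ∧ q ∉ W0)
    (hQ0 : ∀ z, z ∉ W0 → Q z = ∅)
    (hQd : ∀ x y, x ≠ y → Disjoint (Q x) (Q y))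
    (hdeg : ∀ z, z ∉ D → (D.filter (Adj z)).card ≤ 2 + (Q z).card) :
    ∃ β τ : Finset V → Finset V,
      ∀ C, HasEdge Adj C → β C ⊆ C ∧ C ⊆ τ C ∧ D.card ≤ (τ C).card ∧ HasEdge Adj (β C) ∧
        ∀ C', β C ⊆ C' → C' ⊆ τ C → β C' = β C ∧ τ C' = τ C := by
  classical
  choose a b hab using fun Y : Finset V => max_ideal_intervals Y
  let N : Finset V → Finset V := fun Z => Finset.univ.filter (fun v => ∃ z ∈ Z, Adj z v)
  have hN : ∀ Z v, v ∈ N Z ↔ ∃ z ∈ Z, Adj z v := by intro Z v; simp [N]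
  -- everything depends on `F = C ∩ W0` and `Z`
  let Y0 : Finset V → Finset V := fun F => N F \ W0
  let U : Finset V → Finset V := fun F => Y0 F ∪ D
  let Z : Finset V → Finset V := fun C => C \ U (C ∩ W0)
  let Y : Finset V → Finset V := fun C => Y0 (C ∩ W0) ∪ (N (Z C) ∩ D)
  have hUW : ∀ F, Disjoint (U F) W0 := by
    intro F
    rw [Finset.disjoint_union_left]
    exact ⟨Finset.sdiff_disjoint, hDW⟩
  have hYU : ∀ C, Y C ⊆ U (C ∩ W0) := by
    intro C
    exact Finset.union_subset_union_right Finset.inter_subset_right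
  have hFZ : ∀ C, C ∩ W0 ⊆ Z C := by
    intro C v hv
    rw [Finset.mem_inter] at hv
    refine Finset.mem_sdiff.mpr ⟨hv.1, fun h => ?_⟩
    exact Finset.disjoint_left.mp (hUW _) h hv.2
  have hkeyF : ∀ C C', Z C ⊆ C' → C' ⊆ Z C ∪ U (C ∩ W0) → C' ∩ W0 = C ∩ W0 := by
    intro C C' h1 h2
    ext v
    simp only [Finset.mem_inter]
    constructor
    · rintro ⟨hv, hw⟩
      refine ⟨?_, hw⟩
      rcases Finset.mem_union.mp (h2 hv) with h | h
      · exact (Finset.mem_sdiff.mp h).1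
      · exact absurd hw (Finset.disjoint_left.mp (hUW _) h)
    · rintro ⟨hv, hw⟩
      exact ⟨h1 (hFZ C (Finset.mem_inter.mpr ⟨hv, hw⟩)), hw⟩
  have hkeyZ : ∀ C C', Z C ⊆ C' → C' ⊆ Z C ∪ U (C ∩ W0) → Z C' = Z C := by
    intro C C' h1 h2
    have hF := hkeyF C C' h1 h2
    change C' \ U (C' ∩ W0) = Z C
    rw [hF]
    ext v
    simp only [Finset.mem_sdiff]
    constructor
    · rintro ⟨hv, hu⟩
      rcases Finset.mem_union.mp (h2 hv) with h | h
      · exact h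
      · exact absurd h hu
    · intro hv
      exact ⟨h1 hv, (Finset.mem_sdiff.mp hv).2⟩
  let β : Finset V → Finset V := fun C =>
    if HasEdge Adj (Z C) then Z C else Z C ∪ a (Y C) (C ∩ Y C)
  let τ : Finset V → Finset V := fun C =>
    if HasEdge Adj (Z C) then Z C ∪ U (C ∩ W0) else
      Z C ∪ ((U (C ∩ W0) \ Y C) ∪ b (Y C) (C ∩ Y C))
  refine ⟨β, τ, ?_⟩
  intro C hC
  have hCZU : C ⊆ Z C ∪ U (C ∩ W0) := by
    intro v hv
    by_cases h : v ∈ U (C ∩ W0)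
    · exact Finset.mem_union_right _ h
    · exact Finset.mem_union_left _ (Finset.mem_sdiff.mpr ⟨hv, h⟩)
  have hZC : Z C ⊆ C := Finset.sdiff_subset
  by_cases hE : HasEdge Adj (Z C)
  · have hβ : β C = Z C := if_pos hE
    have hτ : τ C = Z C ∪ U (C ∩ W0) := if_pos hE
    rw [hβ, hτ]
    refine ⟨hZC, hCZU, Finset.card_le_card ?_, hE, ?_⟩
    · exact Finset.subset_union_right.trans Finset.subset_union_right
    · intro C' h1 h2
      have hZ := hkeyZ C C' h1 h2
      have hF := hkeyF C C' h1 h2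
      simp only [β, τ]
      rw [hZ, hF, if_pos hE, if_pos hE]
      exact ⟨rfl, rfl⟩
  · have hβ : β C = Z C ∪ a (Y C) (C ∩ Y C) := if_neg hE
    have hτ : τ C = Z C ∪ ((U (C ∩ W0) \ Y C) ∪ b (Y C) (C ∩ Y C)) := if_neg hE
    have hXne : (C ∩ Y C).Nonempty := by
      by_contra hemp
      rw [Finset.not_nonempty_iff_eq_empty] at hemp
      have hno : ∀ v ∈ C, v ∉ Y C := by
        intro v hv hvY
        have : v ∈ C ∩ Y C := Finset.mem_inter.mpr ⟨hv, hvY⟩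
        rw [hemp] at this
        simp at this
      have hcl : ∀ v ∈ C, v ∈ Z C ∨ v ∈ D := by
        intro v hv
        rcases Finset.mem_union.mp (hCZU hv) with h | h
        · exact Or.inl h
        · rcases Finset.mem_union.mp h with h | h
          · exact absurd (Finset.mem_union_left _ h) (hno v hv)
          · exact Or.inr h
      have hZD : ∀ x ∈ Z C, ∀ y ∈ D, y ∈ C → ¬ Adj x y := by
        intro x hx y hy hyC hxy
        exact hno y hyC (Finset.mem_union_right _
          (Finset.mem_inter.mpr ⟨(hN _ _).2 ⟨x, hx, hxy⟩, hy⟩))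
      obtain ⟨x, hx, y, hy, hxy⟩ := hC
      rcases hcl x hx with h1 | h1 <;> rcases hcl y hy with h2 | h2
      · exact hE ⟨x, h1, y, h2, hxy⟩
      · exact hZD x h1 y h2 hy hxy
      · exact hZD y h2 x h1 hx (hsymm _ _ hxy)
      · exact hD ⟨x, h1, y, h2, hxy⟩
    obtain ⟨ha, hb, hbY, hane, hcard, hint⟩ := hab (Y C) (C ∩ Y C) Finset.inter_subset_right hXne
    have hZU : Disjoint (Z C) (U (C ∩ W0)) := Finset.sdiff_disjoint
    have hτsub : τ C ⊆ Z C ∪ U (C ∩ W0) := by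
      rw [hτ]
      apply Finset.union_subset_union_right
      exact Finset.union_subset Finset.sdiff_subset (hbY.trans (hYU C))
    refine ⟨?_, ?_, ?_, ?_, ?_⟩
    · rw [hβ]
      exact Finset.union_subset hZC (ha.trans Finset.inter_subset_left)
    · rw [hτ]
      intro v hv
      rcases Finset.mem_union.mp (hCZU hv) with h | h
      · exact Finset.mem_union_left _ h
      · apply Finset.mem_union_right
        by_cases hy : v ∈ Y C
        · exact Finset.mem_union_right _ (hb (Finset.mem_inter.mpr ⟨hv, hy⟩))
        · exact Finset.mem_union_left _ (Finset.mem_sdiff.mpr ⟨h, hy⟩)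
    · rw [hτ]
      have c1 : (Z C ∪ ((U (C ∩ W0) \ Y C) ∪ b (Y C) (C ∩ Y C))).card =
          (Z C).card + ((U (C ∩ W0) \ Y C).card + (b (Y C) (C ∩ Y C)).card) := by
        rw [Finset.card_union_of_disjoint, Finset.card_union_of_disjoint]
        · exact Finset.disjoint_of_subset_right hbY Finset.sdiff_disjoint
        · apply Finset.disjoint_of_subset_right _ hZU
          exact Finset.union_subset Finset.sdiff_subset (hbY.trans (hYU C))
      have c2 : (U (C ∩ W0) \ Y C).card + (Y C).card = (U (C ∩ W0)).card :=
        Finset.card_sdiff_add_card_eq_card (hYU C)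
      have c3 : (U (C ∩ W0)).card = (Y0 (C ∩ W0) \ D).card + D.card := by
        change (Y0 (C ∩ W0) ∪ D).card = _
        rw [← Finset.sdiff_union_self_eq_union, Finset.card_union_of_disjoint]
        exact Finset.sdiff_disjoint
      have c4 : (Y C).card ≤ (Y0 (C ∩ W0) \ D).card + (N (Z C) ∩ D).card := by
        refine (Finset.card_le_card ?_).trans (Finset.card_union_le _ _)
        intro v hv
        rcases Finset.mem_union.mp hv with h | h
        · by_cases hvD : v ∈ D
          · apply Finset.mem_union_right
            obtain ⟨z, hz, hzv⟩ := (hN _ _).1 (Finset.mem_sdiff.mp h).1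
            exact Finset.mem_inter.mpr ⟨(hN _ _).2 ⟨z, hFZ C hz, hzv⟩, hvD⟩
          · exact Finset.mem_union_left _ (Finset.mem_sdiff.mpr ⟨h, hvD⟩)
        · exact Finset.mem_union_right _ h
      have hZD : ∀ z ∈ Z C, z ∉ D := by
        intro z hz hzD
        exact (Finset.mem_sdiff.mp hz).2 (Finset.mem_union_right _ hzD)
      have c5 : (N (Z C) ∩ D).card ≤ ∑ z ∈ Z C, (2 + (Q z).card) := by
        have : N (Z C) ∩ D ⊆ (Z C).biUnion (fun z => D.filter (Adj z)) := by
          intro v hv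
          rw [Finset.mem_inter, hN] at hv
          obtain ⟨⟨z, hz, hzv⟩, hvD⟩ := hv
          exact Finset.mem_biUnion.mpr ⟨z, hz, Finset.mem_filter.mpr ⟨hvD, hzv⟩⟩
        refine ((Finset.card_le_card this).trans Finset.card_biUnion_le).trans ?_
        exact Finset.sum_le_sum fun z hz => hdeg z (hZD z hz)
      have c6 : ∑ z ∈ Z C, (2 + (Q z).card) = 2 * (Z C).card + ((Z C).biUnion Q).card := by
        rw [Finset.sum_add_distrib, Finset.card_biUnion (fun x _ y _ hxy => hQd x y hxy)]
        simp [mul_comm]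
      have c7 : ((Z C).biUnion Q).card ≤ (Y0 (C ∩ W0) \ D).card := by
        apply Finset.card_le_card
        intro q hq
        obtain ⟨z, hz, hqz⟩ := Finset.mem_biUnion.mp hq
        by_cases hzW : z ∈ W0
        · obtain ⟨h1, h2, h3⟩ := hQ z hzW q hqz
          refine Finset.mem_sdiff.mpr ⟨Finset.mem_sdiff.mpr ⟨(hN _ _).2 ⟨z, ?_, h1⟩, h3⟩, h2⟩
          exact Finset.mem_inter.mpr ⟨hZC hz, hzW⟩
        · rw [hQ0 z hzW] at hqz; simp at hqz
      omega
    · rw [hβ]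
      obtain ⟨p, hp⟩ := hane
      have hpY := (Finset.mem_inter.mp (ha hp)).2
      have : ∃ z ∈ Z C, Adj z p := by
        rcases Finset.mem_union.mp hpY with h | h
        · obtain ⟨z, hz, hzv⟩ := (hN _ _).1 (Finset.mem_sdiff.mp h).1
          exact ⟨z, hFZ C hz, hzv⟩
        · exact (hN _ _).1 (Finset.mem_inter.mp h).1
      obtain ⟨z, hz, hzp⟩ := this
      exact ⟨z, Finset.mem_union_left _ hz, p, Finset.mem_union_right _ hp, hzp⟩
    · intro C' h1 h2
      have h1' : Z C ⊆ C' := by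
        refine Finset.Subset.trans ?_ h1
        rw [hβ]; exact Finset.subset_union_left
      have hZ := hkeyZ C C' h1' (h2.trans hτsub)
      have hF := hkeyF C C' h1' (h2.trans hτsub)
      have hY : Y C' = Y C := by simp only [Y]; rw [hZ, hF]
      obtain ⟨e1, e2⟩ := hint (C' ∩ Y C) (by
          intro v hv
          refine Finset.mem_inter.mpr ⟨h1 ?_, (Finset.mem_inter.mp (ha hv)).2⟩
          rw [hβ]; exact Finset.mem_union_right _ hv) (by
          intro v hv
          obtain ⟨hv1, hv2⟩ := Finset.mem_inter.mp hv
          have := h2 hv1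
          rw [hτ] at this
          rcases Finset.mem_union.mp this with h | h
          · exact absurd (hYU C hv2) (Finset.disjoint_left.mp hZU h)
          · rcases Finset.mem_union.mp h with h | h
            · exact absurd hv2 (Finset.mem_sdiff.mp h).2
            · exact h)
      rw [hβ, hτ]
      simp only [β, τ]
      rw [hZ, hF, hY, if_neg hE, if_neg hE, e1, e2]
      exact ⟨rfl, rfl⟩

lemma cAdj_symm (n m : ℕ) (a b : Fin n × Fin m) (h : cAdj n m a b) : cAdj n m b a := by
  obtain ⟨h1, h2, h3⟩ := h
  refine ⟨h1.symm, ?_, ?_⟩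
  · rw [← Int.natAbs_neg, neg_sub]; exact h2
  · rw [abs_sub_comm]; exact h3

lemma cAdj_iff (n m : ℕ) (a b : Fin n × Fin m) : cAdj n m a b ↔
    (a.1.val ≠ b.1.val ∨ a.2.val ≠ b.2.val) ∧
    (a.1.val ≤ b.1.val + 1 ∧ b.1.val ≤ a.1.val + 1 ∨ n ≤ a.1.val + 1 - b.1.val ∨
      n ≤ b.1.val + 1 - a.1.val) ∧
    a.2.val ≤ b.2.val + 1 ∧ b.2.val ≤ a.2.val + 1 := by
  unfold cAdj
  have h0 : a ≠ b ↔ (a.1.val ≠ b.1.val ∨ a.2.val ≠ b.2.val) := by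
    rw [Ne, Prod.ext_iff, Fin.ext_iff, Fin.ext_iff]; tauto
  have := a.1.2
  have := b.1.2
  rw [h0, abs_le]
  refine and_congr_right fun _ => and_congr ?_ ?_
  · omega
  · omega

lemma cAdj_indep_card (n m : ℕ) (hn : 3 ≤ n) (A : Finset (Fin n × Fin m))
    (hA : ¬ HasEdge (cAdj n m) A) : A.card ≤ (n / 2) * ((m + 1) / 2) := by
  classical
  have hno : ∀ a ∈ A, ∀ b ∈ A, ¬ cAdj n m a b := fun a ha b hb h => hA ⟨a, ha, b, hb, h⟩
  have := Finset.card_le_mul_card_image_of_maps_to (s := A) (t := Finset.range ((m+1)/2))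
    (f := fun v => v.2.val / 2) (by
      intro v _
      have := v.2.2
      simp only [Finset.mem_range]; omega) (n / 2) (by
      intro r _
      set B := A.filter (fun v => v.2.val / 2 = r) with hB
      have hBm : ∀ v ∈ B, v ∈ A ∧ v.2.val / 2 = r := fun v hv => Finset.mem_filter.mp hv
      have h1 : (B.image Prod.fst).card = B.card := by
        apply Finset.card_image_of_injOn
        intro u hu v hv huv
        by_contra hne
        have huv' : u.1 = v.1 := huv
        obtain ⟨hu1, hu2⟩ := hBm u hu
        obtain ⟨hv1, hv2⟩ := hBm v hv
        apply hno u hu1 v hv1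
        rw [cAdj_iff]
        have h2 : u.2.val ≠ v.2.val := fun h => hne (Prod.ext huv' (Fin.ext h))
        have h3 : u.1.val = v.1.val := congrArg Fin.val huv'
        omega
      let g : Fin n → Fin n := fun i => ⟨(i.val + 1) % n, Nat.mod_lt _ (by omega)⟩
      have hgv : ∀ i : Fin n, (g i).val = i.val + 1 ∧ i.val + 1 < n ∨ (g i).val = 0 ∧ i.val + 1 = n := by
        intro i
        have := i.2
        by_cases h : i.val + 1 < n
        · left; exact ⟨Nat.mod_eq_of_lt h, h⟩
        · right
          have : i.val + 1 = n := by omega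
          refine ⟨?_, this⟩
          change (i.val + 1) % n = 0
          rw [this]; simp
      have hg : Function.Injective g := by
        intro i j hij
        have h1 := hgv i
        have h2 := hgv j
        rw [hij] at h1
        apply Fin.ext; omega
      have h2 : Disjoint (B.image Prod.fst) ((B.image Prod.fst).image g) := by
        rw [Finset.disjoint_left]
        intro i hi hi'
        obtain ⟨j, hj, hji⟩ := Finset.mem_image.mp hi'
        obtain ⟨u, hu, hui⟩ := Finset.mem_image.mp hi
        obtain ⟨v, hv, hvj⟩ := Finset.mem_image.mp hj
        obtain ⟨hu1, hu2⟩ := hBm u hu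
        obtain ⟨hv1, hv2⟩ := hBm v hv
        apply hno u hu1 v hv1
        rw [cAdj_iff]
        have h3 := hgv j
        rw [hji, ← hui, ← hvj] at h3
        omega
      have h3 := Finset.card_union_of_disjoint h2
      rw [Finset.card_image_of_injective _ hg, h1] at h3
      have h4 := Finset.card_le_univ (B.image Prod.fst ∪ (B.image Prod.fst).image g)
      rw [Fintype.card_fin] at h4
      omega)
  rwa [Finset.card_range] at this

lemma cAdj_intervals (n m : ℕ) (hm3 : m ≤ 3) (hn : 3 ≤ n) :
    ∃ β τ : Finset (Fin n × Fin m) → Finset (Fin n × Fin m),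
      ∀ C, HasEdge (cAdj n m) C → β C ⊆ C ∧ C ⊆ τ C ∧ (n / 2) * ((m + 1) / 2) ≤ (τ C).card ∧
        HasEdge (cAdj n m) (β C) ∧
        ∀ C', β C ⊆ C' → C' ⊆ τ C → β C' = β C ∧ τ C' = τ C := by
  classical
  let D : Finset (Fin n × Fin m) := Finset.univ.filter
    (fun v => (v.1.val % 2 = 0 ∧ v.1.val + 1 < n) ∧ v.2.val % 2 = 0)
  let W0 : Finset (Fin n × Fin m) := Finset.univ.filter
    (fun v => ¬ (v.1.val % 2 = 0 ∧ v.1.val + 1 < n) ∧ v.2.val = 1)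
  let R : Finset (Fin m) := Finset.univ.filter (fun r => r.val % 2 = 0)
  let Q : Fin n × Fin m → Finset (Fin n × Fin m) := fun v =>
    if v ∈ W0 then R.image (fun r => (v.1, r)) else ∅
  have hD : ∀ v, v ∈ D ↔ (v.1.val % 2 = 0 ∧ v.1.val + 1 < n) ∧ v.2.val % 2 = 0 := by
    intro v; simp [D]
  have hW : ∀ v, v ∈ W0 ↔ ¬ (v.1.val % 2 = 0 ∧ v.1.val + 1 < n) ∧ v.2.val = 1 := by
    intro v; simp only [W0, Finset.mem_filter, Finset.mem_univ, true_and]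
  have hRm : ∀ r, r ∈ R ↔ r.val % 2 = 0 := by intro r; simp [R]
  have hR : R.card ≤ 2 := by
    have : R.card ≤ (Finset.univ : Finset Bool).card := by
      apply Finset.card_le_card_of_injOn (fun r => decide (r.val = 0)) (fun _ _ => Finset.mem_coe.mpr (Finset.mem_univ _))
      intro r hr r' hr' h
      have h1 := (hRm r).1 hr
      have h2 := (hRm r').1 hr'
      have := r.2
      have := r'.2
      simp only [decide_eq_decide] at h
      apply Fin.ext; omega
    simpa using this
  have hQmem : ∀ v q, q ∈ Q v → v ∈ W0 ∧ q.1 = v.1 ∧ q.2.val % 2 = 0 := by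
    intro v q hq
    by_cases h : v ∈ W0
    · simp only [Q, if_pos h] at hq
      obtain ⟨r, hr, rfl⟩ := Finset.mem_image.mp hq
      exact ⟨h, rfl, (hRm r).1 hr⟩
    · simp only [Q, if_neg h] at hq
      simp at hq
  have hDcard : (n / 2) * ((m + 1) / 2) ≤ D.card := by
    have h1 : Fintype.card (Fin (n/2) × Fin ((m+1)/2)) = (n / 2) * ((m + 1) / 2) := by simp
    rw [← h1, ← Finset.card_univ]
    apply Finset.card_le_card_of_injOn
      (fun p => ((⟨2 * p.1.val, by have := p.1.2; omega⟩ : Fin n),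
        (⟨2 * p.2.val, by have := p.2.2; omega⟩ : Fin m)))
    · intro p _
      have := p.1.2
      apply Finset.mem_coe.mpr
      rw [hD]
      dsimp only
      omega
    · intro p _ q _ h
      simp only [Prod.mk.injEq, Fin.mk.injEq] at h
      apply Prod.ext <;> apply Fin.ext <;> omega
  obtain ⟨β, τ, h⟩ := graph_intervals (cAdj n m) (cAdj_symm n m) D W0 Q
    (by
      rintro ⟨a, ha, b, hb, hab⟩
      rw [hD] at ha hb
      rw [cAdj_iff] at hab
      omega)
    (by
      rw [Finset.disjoint_left]
      intro v h1 h2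
      rw [hD] at h1
      rw [hW] at h2
      exact h2.1 h1.1)
    (by
      intro f hf q hq
      obtain ⟨-, h1, h2⟩ := hQmem f q hq
      have h1' : q.1.val = f.1.val := congrArg Fin.val h1
      rw [hW] at hf
      have := q.2.2
      have := f.1.2
      rw [cAdj_iff, hD, hW]
      refine ⟨?_, ?_, ?_⟩ <;> omega)
    (by
      intro z hz
      simp only [Q, if_neg hz])
    (by
      intro x y hxy
      rw [Finset.disjoint_left]
      intro q h1 h2
      obtain ⟨a1, a2, -⟩ := hQmem x q h1
      obtain ⟨b1, b2, -⟩ := hQmem y q h2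
      rw [hW] at a1 b1
      exact hxy (Prod.ext (a2.symm.trans b2) (Fin.ext (a1.2.trans b1.2.symm))))
    (by
      intro z hz
      have hzn := z.1.2
      have hzm := z.2.2
      have hmem : ∀ v ∈ D.filter (cAdj n m z), ((v.1.val % 2 = 0 ∧ v.1.val + 1 < n) ∧
          v.2.val % 2 = 0) ∧ cAdj n m z v := by
        intro v hv
        rw [Finset.mem_filter, hD] at hv
        exact hv
      by_cases hzW : z ∈ W0
      · have hQc : (Q z).card = R.card := by
          simp only [Q, if_pos hzW]
          apply Finset.card_image_of_injective
          intro r r' h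
          exact (Prod.mk.inj h).2
        have : (D.filter (cAdj n m z)).card ≤ ((Finset.univ : Finset Bool) ×ˢ R).card := by
          apply Finset.card_le_card_of_injOn
            (fun v => (decide (v.1.val = z.1.val + 1 ∨ z.1.val + 1 = n ∧ v.1.val = 0), v.2))
          · intro v hv
            have := hmem v hv
            simp only [Finset.coe_product, Set.mem_prod, Finset.mem_coe, Finset.mem_univ, true_and]
            exact (hRm _).2 this.1.2
          · intro u hu v hv huv
            have h1 := hmem u hu
            have h2 := hmem v hv
            rw [cAdj_iff] at h1 h2
            rw [hW] at hzW
            simp only [Prod.mk.injEq, decide_eq_decide] at huv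
            refine Prod.ext (Fin.ext ?_) huv.2
            have := huv.1
            omega
        rw [Finset.card_product, Finset.card_univ, Fintype.card_bool] at this
        omega
      · by_cases hz1 : z.2.val = 1
        · have : (D.filter (cAdj n m z)).card ≤ R.card := by
            apply Finset.card_le_card_of_injOn (fun v => v.2)
            · intro v hv
              exact (hRm _).2 (hmem v hv).1.2
            · intro u hu v hv huv
              have h1 := hmem u hu
              have h2 := hmem v hv
              rw [cAdj_iff] at h1 h2
              rw [hW] at hzW
              refine Prod.ext (Fin.ext ?_) huv
              omega
          omega
        · have : (D.filter (cAdj n m z)).card ≤ (Finset.univ : Finset Bool).card := by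
            apply Finset.card_le_card_of_injOn
              (fun v => decide (v.1.val = z.1.val + 1 ∨ z.1.val + 1 = n ∧ v.1.val = 0))
            · intro v hv
              exact Finset.mem_coe.mpr (Finset.mem_univ _)
            · intro u hu v hv huv
              have h1 := hmem u hu
              have h2 := hmem v hv
              rw [cAdj_iff] at h1 h2
              rw [hD] at hz
              simp only [decide_eq_decide] at huv
              have := u.2.2
              have := v.2.2
              refine Prod.ext (Fin.ext ?_) (Fin.ext ?_) <;> omega
          rw [Finset.card_univ, Fintype.card_bool] at this
          omega)
  refine ⟨β, τ, fun C hC => ?_⟩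
  obtain ⟨h1, h2, h3, h4⟩ := h C hC
  exact ⟨h1, h2, hDcard.trans h3, h4⟩

/-- For every `1 ≤ m ≤ 3` and every `n ≥ 3`,
`sdepth(I(C_{n,m})) ≥ sdepth(S_{n,m}/I(C_{n,m}))`. -/
theorem sdepth_edgeIdeal_C_ge_sdepth_quotient (K : Type) [Field K] (n m : ℕ)
    (hm1 : 1 ≤ m) (hm3 : m ≤ 3) (hn : 3 ≤ n) :
    sdepth K (Fin n × Fin m) (edgeIdeal K (cAdj n m)) ≥
      sdepth K (Fin n × Fin m)
        (MvPolynomial (Fin n × Fin m) K ⧸ edgeIdeal K (cAdj n m)) := by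
  obtain ⟨β, τ, h⟩ := cAdj_intervals n m hm3 hn
  refine (sdepth_quot_le K (cAdj n m) _ (cAdj_indep_card n m hn)).trans ?_
  refine le_sdepth_of_intervals K (cAdj n m) (fun v hv => hv.1 rfl) ?_ _ β τ h
  refine ⟨(⟨0, by omega⟩, ⟨0, by omega⟩), (⟨1, by omega⟩, ⟨0, by omega⟩), ?_⟩
  rw [cAdj_iff]
  simp
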